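/- arXiv:2406.19134 — 3 statements merged into one kernel-verified Lean document; each statement's English description precedes it below -/
import Mathlib

section
/- Let D be a finite directed graph with distinct vertices s and t, and let u and u' be distinct vertices in V(D) \ {s,t} having identical in-neighborhoods and identical out-neighborhoods. If S is a vertex (s,t)-cut of D with u ∈ S and u' ∉ S, then S \ {u} is also a vertex (s,t)-cut of D. -/
/-- Reachability in the digraph `D` after deleting the vertex set `S`. -/
def DReachAvoid {V : Type*} (D : V → V → Prop) (S : Set V) (u v : V) : Prop :=
  Relation.ReflTransGen (fun x y => D x y ∧ x ∉ S ∧ y ∉ S) u v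

/-- `S` is a vertex (s,t)-cut of the digraph `D`. -/
def IsDVertexCut {V : Type*} (D : V → V → Prop) (s t : V) (S : Set V) : Prop :=
  s ∉ S ∧ t ∉ S ∧ ¬ DReachAvoid D S s t

/-- Let `D` be a finite digraph with distinct vertices `s` and `t`, and
let `u ≠ u'` be vertices of `V(D) \ {s,t}` with identical in-neighborhoods and
identical out-neighborhoods.  If `S` is a vertex (s,t)-cut with `u ∈ S` and
`u' ∉ S`, then `S \ {u}` is also a vertex (s,t)-cut. -/
theorem stmt4 {V : Type*} [Fintype V] (D : V → V → Prop) (s t : V) (hst : s ≠ t)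
    (u u' : V) (huu' : u ≠ u')
    (hus : u ≠ s) (hut : u ≠ t) (hu's : u' ≠ s) (hu't : u' ≠ t)
    (hin : ∀ w : V, D w u ↔ D w u')
    (hout : ∀ w : V, D u w ↔ D u' w)
    (S : Set V) (hS : IsDVertexCut D s t S) (huS : u ∈ S) (hu'S : u' ∉ S) :
    IsDVertexCut D s t (S \ {u}) := by
  classical
  obtain ⟨hs, ht, hcut⟩ := hS
  refine ⟨fun h => hs h.1, fun h => ht h.1, fun hpath => hcut ?_⟩
  have hnotMem : ∀ x, x ∉ S \ {u} → (if x = u then u' else x) ∉ S := by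
    intro x hx
    split_ifs with h
    · exact hu'S
    · exact fun hxS => hx ⟨hxS, h⟩
  have hstep : ∀ x y, D x y ∧ x ∉ S \ {u} ∧ y ∉ S \ {u} →
      D (if x = u then u' else x) (if y = u then u' else y) ∧
        (if x = u then u' else x) ∉ S ∧ (if y = u then u' else y) ∉ S := by
    rintro x y ⟨hD, hx, hy⟩
    refine ⟨?_, hnotMem x hx, hnotMem y hy⟩
    split_ifs with hx hy hy
    · subst hx hy
      exact (hout _).mp ((hin _).mp hD)
    · subst hx
      exact (hout _).mp hD
    · subst hy
      exact (hin _).mp hD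
    · exact hD
  have hlift := Relation.ReflTransGen.lift
    (p := fun x y => D x y ∧ x ∉ S ∧ y ∉ S) (fun x => if x = u then u' else x)
    hstep _ _ hpath
  simpa only [DReachAvoid, Function.onFun, if_neg hus.symm, if_neg hut.symm] using hlift
end

section
/- Let G be a finite simple undirected graph, T ⊆ V(G) a set of terminals with |T| ≥ 3, and S a minimal multiway cut for T such that ⟨G,T,S⟩ is a good configuration. Then no multiway cut for T is fully contained in the vertex set of a terminal component of G − S. -/
/-- Reachability in the undirected graph `G` after deleting the vertex set `S`. -/
def ReachAvoid {V : Type*} (G : SimpleGraph V) (S : Set V) (u v : V) : Prop :=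
  Relation.ReflTransGen (fun x y => G.Adj x y ∧ x ∉ S ∧ y ∉ S) u v

/-- `S` is a multiway cut for the terminal set `T` in `G`: `S ⊆ V(G) \ T` and every
connected component of `G − S` contains at most one vertex of `T`. -/
def IsMultiwayCut {V : Type*} (G : SimpleGraph V) (T S : Set V) : Prop :=
  S ∩ T = ∅ ∧ ∀ t₁ ∈ T, ∀ t₂ ∈ T, t₁ ≠ t₂ → ¬ ReachAvoid G S t₁ t₂

/-- `S` is a minimal multiway cut for `T` in `G`. -/
def IsMinimalMultiwayCut {V : Type*} (G : SimpleGraph V) (T S : Set V) : Prop :=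
  IsMultiwayCut G T S ∧ ∀ S' : Set V, S' ⊂ S → ¬ IsMultiwayCut G T S'

/-- The connected component of `G − S` containing `x`. -/
def CompAvoid {V : Type*} (G : SimpleGraph V) (S : Set V) (x : V) : Set V :=
  {y | ReachAvoid G S x y}

/-- Reachability inside the induced subgraph `G[S]`. -/
def ReachIn {V : Type*} (G : SimpleGraph V) (S : Set V) (u v : V) : Prop :=
  Relation.ReflTransGen (fun x y => G.Adj x y ∧ x ∈ S ∧ y ∈ S) u v

/-- The connected component of the induced subgraph `G[S]` containing `w`. -/
def SCompOf {V : Type*} (G : SimpleGraph V) (S : Set V) (w : V) : Set V :=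
  {y | ReachIn G S w y}

/-- Two vertex sets are adjacent if some vertex of one has a neighbor in the other. -/
def AdjSets {V : Type*} (G : SimpleGraph V) (C D : Set V) : Prop :=
  ∃ c ∈ C, ∃ d ∈ D, G.Adj c d

/-- The terminal components of `G − S`: components of `G − S` containing a terminal. -/
def TermComps {V : Type*} (G : SimpleGraph V) (T S : Set V) : Set (Set V) :=
  {C | ∃ t ∈ T, C = CompAvoid G S t}

/-- `C` is a large component of `G − S`: a component of `G − S` adjacent to every
connected component of `G[S]`. -/
def IsLargeComp {V : Type*} (G : SimpleGraph V) (S : Set V) (C : Set V) : Prop :=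
  (∃ x : V, x ∉ S ∧ C = CompAvoid G S x) ∧ ∀ w ∈ S, AdjSets G C (SCompOf G S w)

/-- The configuration `⟨G,T,S⟩` is bad: every connected component of `G[S]` is
adjacent to exactly two terminal components of `G − S`, and `G − S` has a large
component. -/
def IsBadConfig {V : Type*} (G : SimpleGraph V) (T S : Set V) : Prop :=
  (∀ w ∈ S, ∃ C₁ C₂ : Set V, C₁ ≠ C₂ ∧
      {C | C ∈ TermComps G T S ∧ AdjSets G C (SCompOf G S w)} = {C₁, C₂}) ∧
  ∃ C : Set V, IsLargeComp G S C

/-- The configuration `⟨G,T,S⟩` is good if it is not bad. -/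
def IsGoodConfig {V : Type*} (G : SimpleGraph V) (T S : Set V) : Prop :=
  ¬ IsBadConfig G T S

theorem ReachAvoid.symm {V : Type*} {G : SimpleGraph V} {S : Set V} {u v : V}
    (h : ReachAvoid G S u v) : ReachAvoid G S v u := by
  induction h with
  | refl => exact .refl
  | tail _ hbc ih => exact .head ⟨hbc.1.symm, hbc.2.2, hbc.2.1⟩ ih

theorem ReachIn.symm {V : Type*} {G : SimpleGraph V} {S : Set V} {u v : V}
    (h : ReachIn G S u v) : ReachIn G S v u := by
  induction h with
  | refl => exact .refl
  | tail _ hbc ih => exact .head ⟨hbc.1.symm, hbc.2.2, hbc.2.1⟩ ih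

theorem ReachAvoid.notMem {V : Type*} {G : SimpleGraph V} {S : Set V} {u v : V}
    (h : ReachAvoid G S u v) (hu : u ∉ S) : v ∉ S := by
  induction h with
  | refl => exact hu
  | tail _ hbc _ => exact hbc.2.2

theorem ReachIn.mem {V : Type*} {G : SimpleGraph V} {S : Set V} {u v : V}
    (h : ReachIn G S u v) (hu : u ∈ S) : v ∈ S := by
  induction h with
  | refl => exact hu
  | tail _ hbc _ => exact hbc.2.2

/-- Connectivity in `G − S` persists in `G − S'` when `S'` misses the component. -/
theorem ReachAvoid.of_disjoint_compAvoid {V : Type*} {G : SimpleGraph V} {S S' : Set V} {u v : V}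
    (h : ReachAvoid G S u v) (hd : Disjoint S' (CompAvoid G S u)) : ReachAvoid G S' u v := by
  induction h with
  | refl => exact .refl
  | tail hab hbc ih =>
    exact ih.tail ⟨hbc.1, fun hb => hd.notMem_of_mem_left hb hab,
      fun hc => hd.notMem_of_mem_left hc (hab.tail hbc)⟩

theorem ReachIn.reachAvoid {V : Type*} {G : SimpleGraph V} {S S' : Set V} {u v : V}
    (h : ReachIn G S u v) (hd : Disjoint S' S) : ReachAvoid G S' u v := by
  induction h with
  | refl => exact .refl
  | tail _ hbc ih =>
    exact ih.tail
      ⟨hbc.1, hd.notMem_of_mem_right hbc.2.1, hd.notMem_of_mem_right hbc.2.2⟩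

/-- Restoring one deleted vertex `w` either creates no new connection from `u` to `v`, or `w` has
a neighbor in the component of `u`. -/
theorem ReachAvoid.of_diff_singleton {V : Type*} {G : SimpleGraph V} {S : Set V} {w u v : V}
    (h : ReachAvoid G (S \ {w}) u v) (hu : u ∉ S) :
    ReachAvoid G S u v ∨ ∃ c ∈ CompAvoid G S u, G.Adj c w := by
  induction h with
  | refl => exact .inl .refl
  | @tail b c _ hbc ih =>
    rcases ih with hb | hw
    · by_cases hcw : c = w
      · exact .inr ⟨b, hb, hcw ▸ hbc.1⟩
      · exact .inl (hb.tail ⟨hbc.1, hb.notMem hu, fun hc => hbc.2.2 ⟨hc, hcw⟩⟩)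
    · exact .inr hw

theorem IsMultiwayCut.notMem {V : Type*} {G : SimpleGraph V} {T S : Set V}
    (hS : IsMultiwayCut G T S) {t : V} (ht : t ∈ T) : t ∉ S :=
  fun h => Set.notMem_empty t (hS.1 ▸ ⟨h, ht⟩)

theorem IsMultiwayCut.compAvoid_ne {V : Type*} {G : SimpleGraph V} {T S : Set V}
    (hS : IsMultiwayCut G T S) {t₁ t₂ : V} (ht₁ : t₁ ∈ T) (ht₂ : t₂ ∈ T) (hne : t₁ ≠ t₂) :
    CompAvoid G S t₁ ≠ CompAvoid G S t₂ := fun h =>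
  hS.2 t₁ ht₁ t₂ ht₂ hne (h.symm ▸ Relation.ReflTransGen.refl : t₂ ∈ CompAvoid G S t₁)

/-- Every vertex of a minimal multiway cut has neighbors in two distinct terminal components. -/
theorem IsMinimalMultiwayCut.exists_adjSets {V : Type*} {G : SimpleGraph V} {T S : Set V}
    (hS : IsMinimalMultiwayCut G T S) {w : V} (hw : w ∈ S) :
    ∃ t₁ ∈ T, ∃ t₂ ∈ T, t₁ ≠ t₂ ∧ AdjSets G (CompAvoid G S t₁) (SCompOf G S w) ∧
      AdjSets G (CompAvoid G S t₂) (SCompOf G S w) := by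
  have hnot := hS.2 (S \ {w}) (Set.sdiff_singleton_ssubset.2 hw)
  have hdisj : S \ {w} ∩ T = ∅ :=
    Set.subset_empty_iff.1 (hS.1.1 ▸ Set.inter_subset_inter_left T Set.sdiff_subset)
  simp only [IsMultiwayCut, hdisj, true_and, not_forall, not_not] at hnot
  obtain ⟨t₁, ht₁, t₂, ht₂, hne, hr⟩ := hnot
  have adj_of {a b : V} (ha : a ∈ T) (hb : b ∈ T) (hab : a ≠ b)
      (h : ReachAvoid G (S \ {w}) a b) : AdjSets G (CompAvoid G S a) (SCompOf G S w) := by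
    obtain ⟨c, hc, hcw⟩ :=
      (h.of_diff_singleton (hS.1.notMem ha)).resolve_left (hS.1.2 a ha b hb hab)
    exact ⟨c, hc, w, .refl, hcw⟩
  exact ⟨t₁, ht₁, t₂, ht₂, hne, adj_of ht₁ ht₂ hne hr, adj_of ht₂ ht₁ hne.symm hr.symm⟩

/-- If `S'` misses `S` and the component of `u`, then that component is connected in `G − S'` to
each component of `G[S]` adjacent to it. -/
theorem AdjSets.reachAvoid {V : Type*} {G : SimpleGraph V} {S S' : Set V} {u w : V}
    (h : AdjSets G (CompAvoid G S u) (SCompOf G S w)) (hw : w ∈ S)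
    (hdS : Disjoint S' S) (hdu : Disjoint S' (CompAvoid G S u)) : ReachAvoid G S' u w := by
  obtain ⟨c, hc, d, hd, hcd⟩ := h
  exact ((ReachAvoid.of_disjoint_compAvoid hc hdu).tail
    ⟨hcd, hdu.notMem_of_mem_right hc, hdS.notMem_of_mem_right (ReachIn.mem hd hw)⟩).trans
    ((ReachIn.symm hd).reachAvoid hdS)

/-- if `|T| ≥ 3`, `S` is a minimal multiway cut for `T` and `⟨G,T,S⟩`
is a good configuration, then no multiway cut for `T` is fully contained in the
vertex set of a terminal component of `G − S`. -/
theorem stmt11 {V : Type*} [Fintype V] (G : SimpleGraph V) (T : Set V)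
    (hT : 3 ≤ T.ncard) (S : Set V)
    (hS : IsMinimalMultiwayCut G T S) (hgood : IsGoodConfig G T S) :
    ¬ ∃ S' : Set V, IsMultiwayCut G T S' ∧ ∃ t ∈ T, S' ⊆ CompAvoid G S t := by
  rintro ⟨S', hS', t, ht, hsub⟩
  have hdS : Disjoint S' S :=
    Set.disjoint_left.2 fun x hx => ReachAvoid.notMem (hsub hx) (hS.1.notMem ht)
  have hdcomp {u : V} (hu : u ∈ T) (hut : u ≠ t) : Disjoint S' (CompAvoid G S u) :=
    Set.disjoint_left.2 fun x hx hux =>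
      hS.1.2 u hu t ht hut (Relation.ReflTransGen.trans hux (ReachAvoid.symm (hsub hx)))
  have huniq {w u v : V} (hw : w ∈ S) (hu : u ∈ T) (hv : v ∈ T) (hut : u ≠ t) (hvt : v ≠ t)
      (hau : AdjSets G (CompAvoid G S u) (SCompOf G S w))
      (hav : AdjSets G (CompAvoid G S v) (SCompOf G S w)) : u = v := by
    by_contra hne
    exact hS'.2 u hu v hv hne ((hau.reachAvoid hw hdS (hdcomp hu hut)).trans
      (hav.reachAvoid hw hdS (hdcomp hv hvt)).symm)
  have hpair {w : V} (hw : w ∈ S) : AdjSets G (CompAvoid G S t) (SCompOf G S w) ∧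
      ∃ u ∈ T, u ≠ t ∧ AdjSets G (CompAvoid G S u) (SCompOf G S w) := by
    obtain ⟨t₁, ht₁, t₂, ht₂, hne, ha₁, ha₂⟩ := hS.exists_adjSets hw
    by_cases h₁ : t₁ = t
    · subst h₁
      exact ⟨ha₁, t₂, ht₂, hne.symm, ha₂⟩
    · by_cases h₂ : t₂ = t
      · subst h₂
        exact ⟨ha₂, t₁, ht₁, hne, ha₁⟩
      · exact absurd (huniq hw ht₁ ht₂ h₁ h₂ ha₁ ha₂) hne
  refine hgood ⟨fun w hw => ?_, CompAvoid G S t, ⟨t, hS.1.notMem ht, rfl⟩, fun w hw => (hpair hw).1⟩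
  obtain ⟨hat, u, hu, hut, hau⟩ := hpair hw
  refine ⟨CompAvoid G S t, CompAvoid G S u, hS.1.compAvoid_ne ht hu hut.symm, ?_⟩
  ext C
  constructor
  · rintro ⟨⟨v, hv, rfl⟩, hav⟩
    by_cases hvt : v = t
    · exact .inl (hvt ▸ rfl)
    · exact .inr (huniq hw hv hu hvt hut hav hau ▸ rfl)
  · rintro (rfl | rfl)
    · exact ⟨⟨t, ht, rfl⟩, hat⟩
    · exact ⟨⟨u, hu, rfl⟩, hau⟩
end

section
/- For all positive integers p and q and every choice of j_1, …, j_p ∈ [q], the pair M_W = (V(G_{p,q}), 𝓘_W) is a matroid of rank 2p. -/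
/-- The vertex set of the graph `G_{p,q}`: vertices `s`, `t`, `a i j` and `b i j`
for `i ∈ [p]`, `j ∈ [q]`. -/
inductive Vpq (p q : ℕ) : Type where
  | s : Vpq p q
  | t : Vpq p q
  | a : Fin p → Fin q → Vpq p q
  | b : Fin p → Fin q → Vpq p q
  deriving DecidableEq, Fintype

/-- The base adjacency relation of `G_{p,q}` (to be symmetrized): for each `i`,
`s` is adjacent to `a i 1` and `b i 1`, `t` is adjacent to `a i q` and `b i q`,
and for each `j ∈ [q−1]` each of `a i j` and `b i j` is adjacent to both
`a i (j+1)` and `b i (j+1)`. -/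
def basePQ (p q : ℕ) : Vpq p q → Vpq p q → Prop
  | .s, .a _ j => j.val = 0
  | .s, .b _ j => j.val = 0
  | .a _ j, .t => j.val = q - 1
  | .b _ j, .t => j.val = q - 1
  | .a i j, .a i' j' => i = i' ∧ j'.val = j.val + 1
  | .a i j, .b i' j' => i = i' ∧ j'.val = j.val + 1
  | .b i j, .a i' j' => i = i' ∧ j'.val = j.val + 1
  | .b i j, .b i' j' => i = i' ∧ j'.val = j.val + 1
  | _, _ => False

/-- The graph `G_{p,q}`. -/
def Gpq (p q : ℕ) : SimpleGraph (Vpq p q) := SimpleGraph.fromRel (basePQ p q)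

/-- The set `W = ⋃_{i=1}^p {a^i_{j_i}, b^i_{j_i}}` determined by `j : Fin p → Fin q`. -/
def WSet (p q : ℕ) (jv : Fin p → Fin q) : Finset (Vpq p q) :=
  Finset.image (fun i => Vpq.a i (jv i)) Finset.univ ∪
    Finset.image (fun i => Vpq.b i (jv i)) Finset.univ

/-- The family `𝓘_W` of independent sets of the matroid `M_W` (with `k = 2p`):
subsets of `V(G_{p,q}) \ {s,t}` of size at most `k − 1` are independent; sets
containing `s` or `t` or of size at least `k + 1` are not; a set `X` of size `k` is
independent iff `X = W`, or `|A_i ∩ X| ≥ 2` or `|B_i ∩ X| ≥ 2` for some `i`, or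
`a^i_h, b^i_j ∈ X` for some `i` and distinct `h, j`. -/
def IndW (p q : ℕ) (jv : Fin p → Fin q) (X : Finset (Vpq p q)) : Prop :=
  Vpq.s ∉ X ∧ Vpq.t ∉ X ∧
    (X.card ≤ 2 * p - 1 ∨
      (X.card = 2 * p ∧
        (X = WSet p q jv ∨
          ∃ i : Fin p,
            (∃ j j' : Fin q, j ≠ j' ∧ Vpq.a i j ∈ X ∧ Vpq.a i j' ∈ X) ∨
            (∃ j j' : Fin q, j ≠ j' ∧ Vpq.b i j ∈ X ∧ Vpq.b i j' ∈ X) ∨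
            (∃ h j : Fin q, h ≠ j ∧ Vpq.a i h ∈ X ∧ Vpq.b i j ∈ X))))

@[simp]
lemma mem_WSet_a {p q : ℕ} {f : Fin p → Fin q} {i : Fin p} {j : Fin q} :
    Vpq.a i j ∈ WSet p q f ↔ f i = j := by
  simp [WSet]

@[simp]
lemma mem_WSet_b {p q : ℕ} {f : Fin p → Fin q} {i : Fin p} {j : Fin q} :
    Vpq.b i j ∈ WSet p q f ↔ f i = j := by
  simp [WSet]

@[simp]
lemma s_notMem_WSet {p q : ℕ} (f : Fin p → Fin q) : Vpq.s ∉ WSet p q f := by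
  simp [WSet]

@[simp]
lemma t_notMem_WSet {p q : ℕ} (f : Fin p → Fin q) : Vpq.t ∉ WSet p q f := by
  simp [WSet]

lemma card_WSet {p q : ℕ} (f : Fin p → Fin q) : (WSet p q f).card = 2 * p := by
  rw [WSet, Finset.card_union_of_disjoint, Finset.card_image_of_injective,
    Finset.card_image_of_injective, Finset.card_univ, Fintype.card_fin, two_mul]
  · intro i j h
    exact (Vpq.b.inj h).1
  · intro i j h
    exact (Vpq.a.inj h).1
  · simp [Finset.disjoint_left]

lemma eq_of_subset_WSet {p q : ℕ} (hp : 0 < p) {f g : Fin p → Fin q} {X : Finset (Vpq p q)}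
    (hX : 2 * p - 1 ≤ X.card) (hf : X ⊆ WSet p q f) (hg : X ⊆ WSet p q g) : f = g := by
  funext i
  by_contra hne
  have hsub : X ⊆ ((WSet p q f).erase (Vpq.a i (f i))).erase (Vpq.b i (f i)) := by
    intro x hx
    refine Finset.mem_erase.2 ⟨?_, Finset.mem_erase.2 ⟨?_, hf hx⟩⟩ <;>
    · rintro rfl
      have := hg hx
      simp_all
  have hcard := Finset.card_le_card hsub
  rw [Finset.card_erase_of_mem (by simp), Finset.card_erase_of_mem (by simp),
    card_WSet] at hcard
  omega

/-- The projection `G_{p,q} → G_{p,1}` forgetting the second index. -/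
def Vpq.forgetLayer {p q : ℕ} : Vpq p q → Vpq p 1
  | .s => .s
  | .t => .t
  | .a i _ => .a i 0
  | .b i _ => .b i 0

lemma exists_eq_WSet {p q : ℕ} {X : Finset (Vpq p q)} (hs : Vpq.s ∉ X) (ht : Vpq.t ∉ X)
    (hX : X.card = 2 * p)
    (haa : ∀ i j j', Vpq.a i j ∈ X → Vpq.a i j' ∈ X → j = j')
    (hbb : ∀ i j j', Vpq.b i j ∈ X → Vpq.b i j' ∈ X → j = j')
    (hab : ∀ i j j', Vpq.a i j ∈ X → Vpq.b i j' ∈ X → j = j') :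
    ∃ f, X = WSet p q f := by
  have hinj : Set.InjOn Vpq.forgetLayer (X : Set (Vpq p q)) := by
    rintro (_ | _ | ⟨i, j⟩ | ⟨i, j⟩) hx (_ | _ | ⟨i', j'⟩ | ⟨i', j'⟩) hy h <;>
      simp_all [Vpq.forgetLayer]
    · exact haa _ _ _ hx hy
    · exact hbb _ _ _ hx hy
  have himage : X.image Vpq.forgetLayer = WSet p 1 0 := by
    refine Finset.eq_of_subset_of_card_le ?_ ?_
    · intro y hy
      obtain ⟨(_ | _ | ⟨i, j⟩ | ⟨i, j⟩), hx, rfl⟩ := Finset.mem_image.1 hy <;>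
        simp_all [Vpq.forgetLayer]
    · rw [Finset.card_image_of_injOn hinj, hX, card_WSet]
  have ha : ∀ i, ∃ j, Vpq.a i j ∈ X := by
    intro i
    have : Vpq.a i 0 ∈ X.image Vpq.forgetLayer := by simp [himage]
    obtain ⟨(_ | _ | ⟨i', j⟩ | ⟨i', j⟩), hx, h⟩ := Finset.mem_image.1 this <;>
      simp [Vpq.forgetLayer] at h
    exact ⟨j, h ▸ hx⟩
  choose f hf using ha
  refine ⟨f, Finset.eq_of_subset_of_card_le ?_ (by rw [hX, card_WSet])⟩
  rintro (_ | _ | ⟨i, j⟩ | ⟨i, j⟩) hx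
  · exact absurd hx hs
  · exact absurd hx ht
  · simpa using haa _ _ _ (hf i) hx
  · simpa using hab _ _ _ (hf i) hx

lemma exists_eq_WSet_of_not_IndW {p q : ℕ} {jv : Fin p → Fin q} {X : Finset (Vpq p q)}
    (hs : Vpq.s ∉ X) (ht : Vpq.t ∉ X) (hX : X.card = 2 * p) (hdep : ¬ IndW p q jv X) :
    ∃ f, X = WSet p q f := by
  have hno : ¬ ∃ i : Fin p,
      (∃ j j' : Fin q, j ≠ j' ∧ Vpq.a i j ∈ X ∧ Vpq.a i j' ∈ X) ∨
      (∃ j j' : Fin q, j ≠ j' ∧ Vpq.b i j ∈ X ∧ Vpq.b i j' ∈ X) ∨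
      (∃ h j : Fin q, h ≠ j ∧ Vpq.a i h ∈ X ∧ Vpq.b i j ∈ X) :=
    fun h => hdep ⟨hs, ht, .inr ⟨hX, .inr h⟩⟩
  refine exists_eq_WSet hs ht hX ?_ ?_ ?_ <;> intro i j j' hj hj' <;> by_contra hne
  · exact hno ⟨i, .inl ⟨j, j', hne, hj, hj'⟩⟩
  · exact hno ⟨i, .inr (.inl ⟨j, j', hne, hj, hj'⟩)⟩
  · exact hno ⟨i, .inr (.inr ⟨j, j', hne, hj, hj'⟩)⟩

lemma IndW.card_le {p q : ℕ} {jv : Fin p → Fin q} {X : Finset (Vpq p q)}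
    (hX : IndW p q jv X) : X.card ≤ 2 * p := by
  rcases hX with ⟨-, -, h | h⟩ <;> omega

lemma IndW_WSet {p q : ℕ} (jv : Fin p → Fin q) : IndW p q jv (WSet p q jv) :=
  ⟨s_notMem_WSet jv, t_notMem_WSet jv, .inr ⟨card_WSet jv, .inl rfl⟩⟩

lemma IndW.subset {p q : ℕ} {jv : Fin p → Fin q} {X Y : Finset (Vpq p q)}
    (hY : IndW p q jv Y) (hXY : X ⊆ Y) : IndW p q jv X := by
  rcases hXY.eq_or_ssubset with rfl | hlt
  · exact hY
  · have := Finset.card_lt_card hlt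
    have := hY.card_le
    exact ⟨fun h => hY.1 (hXY h), fun h => hY.2.1 (hXY h), .inl (by omega)⟩

lemma IndW.exchange {p q : ℕ} (hp : 0 < p) {jv : Fin p → Fin q} {X Y : Finset (Vpq p q)}
    (hX : IndW p q jv X) (hY : IndW p q jv Y) (hlt : X.card < Y.card) :
    ∃ e ∈ Y, e ∉ X ∧ IndW p q jv (insert e X) := by
  by_contra! hdep
  have hYcard := hY.card_le
  have hs : ∀ e ∈ Y, Vpq.s ∉ insert e X := by
    intro e he hmem
    rcases Finset.mem_insert.1 hmem with rfl | h
    exacts [hY.1 he, hX.1 h]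
  have ht : ∀ e ∈ Y, Vpq.t ∉ insert e X := by
    intro e he hmem
    rcases Finset.mem_insert.1 hmem with rfl | h
    exacts [hY.2.1 he, hX.2.1 h]
  obtain ⟨e, heY, heX⟩ := Finset.exists_mem_notMem_of_card_lt_card hlt
  have hXcard : X.card + 1 = 2 * p := by
    by_contra hne
    refine hdep e heY heX ⟨hs e heY, ht e heY, .inl ?_⟩
    rw [Finset.card_insert_of_notMem heX]
    omega
  have hW : ∀ e ∈ Y, e ∉ X → ∃ f, insert e X = WSet p q f := fun e he heX =>
    exists_eq_WSet_of_not_IndW (hs e he) (ht e he)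
      (by rw [Finset.card_insert_of_notMem heX, hXcard]) (hdep e he heX)
  have hsub : Y ⊆ insert e X := by
    intro e' he'
    by_cases he'X : e' ∈ X
    · exact Finset.mem_insert_of_mem he'X
    obtain ⟨f, hf⟩ := hW e heY heX
    obtain ⟨g, hg⟩ := hW e' he' he'X
    have hfg : f = g := eq_of_subset_WSet hp (by omega)
      (hf ▸ Finset.subset_insert e X) (hg ▸ Finset.subset_insert e' X)
    rw [hf, hfg, ← hg]
    exact Finset.mem_insert_self e' X
  have hYeq : Y = insert e X := Finset.eq_of_subset_of_card_le hsub <| by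
    rw [Finset.card_insert_of_notMem heX]
    omega
  exact hdep e heY heX (hYeq ▸ hY)

/-- `M_W = (V(G_{p,q}), 𝓘_W)` is a matroid of rank `2p`. -/
theorem stmt16 (p q : ℕ) (hp : 0 < p) (hq : 0 < q) (jv : Fin p → Fin q) :
    -- 𝓘_W contains the empty set
    IndW p q jv ∅ ∧
    -- 𝓘_W is closed under subsets
    (∀ X Y : Finset (Vpq p q), IndW p q jv Y → X ⊆ Y → IndW p q jv X) ∧
    -- 𝓘_W satisfies the exchange axiom
    (∀ X Y : Finset (Vpq p q), IndW p q jv X → IndW p q jv Y → X.card < Y.card →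
      ∃ e ∈ Y, e ∉ X ∧ IndW p q jv (insert e X)) ∧
    -- the rank of M_W is 2p: every maximal independent set has size 2p
    (∀ X : Finset (Vpq p q), IndW p q jv X →
      (∀ e : Vpq p q, e ∉ X → ¬ IndW p q jv (insert e X)) → X.card = 2 * p) := by
  refine ⟨(IndW_WSet jv).subset (Finset.empty_subset _), fun X Y hY hXY => hY.subset hXY,
    fun X Y hX hY hlt => hX.exchange hp hY hlt, fun X hX hmax => ?_⟩
  by_contra hne
  obtain ⟨e, -, heX, he⟩ := hX.exchange hp (IndW_WSet jv)
    (by rw [card_WSet]; exact lt_of_le_of_ne hX.card_le hne)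
  exact hmax e heX he
end
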